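/- Let p be a prime, d ≥ 1, and E ⊆ Z_p^d with E nonempty, and let A, B ⊆ Z_p^d. The Gabor system G(|E|^{-1/2}·1_E, A, B) is an orthonormal basis of L²(Z_p^d) if and only if (E, B) is a spectral pair and (E, A) is a tiling pair. -/

import Mathlib

open Finset

/-- The fixed character `χ(t) = e^{2πi t/p}` of `ℤ/p`. -/
noncomputable def chi (p : ℕ) (t : ZMod p) : ℂ :=
  Complex.exp (2 * Real.pi * Complex.I * (t.val : ℂ) / (p : ℂ))

/-- The dot product on `ℤ_p^d`. -/
def dotp {p d : ℕ} (x y : Fin d → ZMod p) : ZMod p := ∑ i, x i * y i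

/-- The Gabor (time-frequency shifted) function `x ↦ g(x-a) χ(x·b)`. -/
noncomputable def gabor {p d : ℕ} (g : (Fin d → ZMod p) → ℂ) (a b : Fin d → ZMod p) :
    (Fin d → ZMod p) → ℂ :=
  fun x => g (x - a) * chi p (dotp x b)

/-- The inner product of `L²` with counting measure on a finite type. -/
noncomputable def innerC {V : Type*} [Fintype V] (f g : V → ℂ) : ℂ :=
  ∑ x, f x * (starRingEnd ℂ) (g x)

/-- `𝒢(g, A, B)` is an orthonormal basis of `L²(ℤ_p^d)`: the family is orthonormal and
every function is a linear combination of its members. -/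
def IsGaborONB {p d : ℕ} [NeZero p] (g : (Fin d → ZMod p) → ℂ)
    (A B : Finset (Fin d → ZMod p)) : Prop :=
  (∀ a ∈ A, ∀ b ∈ B, ∀ a' ∈ A, ∀ b' ∈ B,
    innerC (gabor g a b) (gabor g a' b') = if a = a' ∧ b = b' then 1 else 0)
  ∧ (∀ f : (Fin d → ZMod p) → ℂ, ∃ c : (Fin d → ZMod p) → (Fin d → ZMod p) → ℂ,
      f = fun x => ∑ a ∈ A, ∑ b ∈ B, c a b * gabor g a b x)

/-- `(E, B)` is a spectral pair: the characters indexed by `B` are pairwise orthogonal in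
`L²(E)` and span it. -/
def IsSpectralPair {p d : ℕ} [NeZero p] (E B : Finset (Fin d → ZMod p)) : Prop :=
  (∀ b ∈ B, ∀ b' ∈ B, b ≠ b' → ∑ x ∈ E, chi p (dotp x (b - b')) = 0)
  ∧ (∀ f : (Fin d → ZMod p) → ℂ, ∃ c : (Fin d → ZMod p) → ℂ,
      ∀ x ∈ E, f x = ∑ b ∈ B, c b * chi p (dotp x b))

/-- `(E, A)` is a tiling pair: `Σ_{a∈A} 1_E(x-a) = 1` for every `x`. -/
def IsTilingPair {p d : ℕ} [NeZero p] (E A : Finset (Fin d → ZMod p)) : Prop :=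
  ∀ x : Fin d → ZMod p, (∑ a ∈ A, if x - a ∈ E then (1 : ℕ) else 0) = 1

lemma chi_ne_zero {p : ℕ} (t : ZMod p) : chi p t ≠ 0 := Complex.exp_ne_zero _

lemma dotp_add_left {p d : ℕ} (x y b : Fin d → ZMod p) :
    dotp (x + y) b = dotp x b + dotp y b := by
  simp [dotp, add_mul, Finset.sum_add_distrib]

lemma dotp_sub_right {p d : ℕ} (x b c : Fin d → ZMod p) :
    dotp x (b - c) = dotp x b - dotp x c := by
  simp [dotp, mul_sub, Finset.sum_sub_distrib]

lemma sqrt_card_ne_zero {V : Type*} {E : Finset V} (hE : E.Nonempty) :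
    ((Real.sqrt E.card : ℝ) : ℂ) ≠ 0 := by
  have : (0 : ℝ) < E.card := by exact_mod_cast hE.card_pos
  exact_mod_cast (Real.sqrt_pos.2 this).ne'

section CharacterLemmas

variable {p d : ℕ} [NeZero p]

lemma chi_eq_stdAddChar (t : ZMod p) : chi p t = ZMod.stdAddChar t := by
  rw [ZMod.stdAddChar_apply, ZMod.toCircle_apply, chi]

lemma chi_zero : chi p 0 = 1 := by
  rw [chi_eq_stdAddChar, AddChar.map_zero_eq_one]

lemma chi_add (s t : ZMod p) : chi p (s + t) = chi p s * chi p t := by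
  simp only [chi_eq_stdAddChar, AddChar.map_add_eq_mul]

lemma conj_chi (t : ZMod p) : (starRingEnd ℂ) (chi p t) = chi p (-t) := by
  rw [chi_eq_stdAddChar, chi_eq_stdAddChar, AddChar.map_neg_eq_conj]

lemma chi_dotp_add_left (x y b : Fin d → ZMod p) :
    chi p (dotp (x + y) b) = chi p (dotp x b) * chi p (dotp y b) := by
  rw [dotp_add_left, chi_add]

lemma chi_dotp_zero_right (x : Fin d → ZMod p) : chi p (dotp x 0) = 1 := by
  simp [dotp, chi_zero]

lemma chi_mul_conj_chi (x b c : Fin d → ZMod p) :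
    chi p (dotp x b) * (starRingEnd ℂ) (chi p (dotp x c)) = chi p (dotp x (b - c)) := by
  rw [conj_chi, ← chi_add, dotp_sub_right, sub_eq_add_neg]

end CharacterLemmas

section GaborIndicator

variable {p d : ℕ} {E A B : Finset (Fin d → ZMod p)}

/-- The normalized indicator function `|E|^{-1/2} 1_E`. -/
noncomputable abbrev normIndicator (E : Finset (Fin d → ZMod p)) : (Fin d → ZMod p) → ℂ :=
  fun x => ((Real.sqrt E.card : ℝ) : ℂ)⁻¹ * (if x ∈ E then 1 else 0)

lemma gabor_normIndicator_of_notMem {a x : Fin d → ZMod p} (b : Fin d → ZMod p)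
    (h : x - a ∉ E) : gabor (normIndicator E) a b x = 0 := by
  simp [gabor, h]

lemma gabor_normIndicator_of_mem {a x : Fin d → ZMod p} (b : Fin d → ZMod p)
    (h : x - a ∈ E) : gabor (normIndicator E) a b x =
      ((Real.sqrt E.card : ℝ) : ℂ)⁻¹ * chi p (dotp x b) := by
  simp [gabor, h]

/-- When the translates of `E` by `A` are disjoint, only one translate contributes to a Gabor
expansion at a given point. -/
lemma sum_gabor_normIndicator
    (hA : ∀ x, ∀ a ∈ A, ∀ a' ∈ A, x - a ∈ E → x - a' ∈ E → a = a')
    (c : (Fin d → ZMod p) → (Fin d → ZMod p) → ℂ) {a x : Fin d → ZMod p}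
    (ha : a ∈ A) (hx : x - a ∈ E) :
    ∑ a ∈ A, ∑ b ∈ B, c a b * gabor (normIndicator E) a b x =
      ∑ b ∈ B, c a b * (((Real.sqrt E.card : ℝ) : ℂ)⁻¹ * chi p (dotp x b)) := by
  rw [Finset.sum_eq_single_of_mem a ha]
  · exact Finset.sum_congr rfl fun b _ => by rw [gabor_normIndicator_of_mem b hx]
  · intro a' ha' hne
    refine Finset.sum_eq_zero fun b _ => ?_
    rw [gabor_normIndicator_of_notMem b fun h => hne (hA x a' ha' a ha h hx), mul_zero]

variable [NeZero p]

/-- The inner product of two members of the Gabor system is a normalized exponential sum over the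
intersection of two translates of `E`. -/
lemma innerC_gabor_normIndicator (E : Finset (Fin d → ZMod p)) (a b a' b' : Fin d → ZMod p) :
    innerC (gabor (normIndicator E) a b) (gabor (normIndicator E) a' b') =
      (E.card : ℂ)⁻¹ * ∑ x with x - a ∈ E ∧ x - a' ∈ E, chi p (dotp x (b - b')) := by
  have hs : ((Real.sqrt E.card : ℝ) : ℂ)⁻¹ * ((Real.sqrt E.card : ℝ) : ℂ)⁻¹ =
      (E.card : ℂ)⁻¹ := by
    rw [← mul_inv, ← Complex.ofReal_mul, Real.mul_self_sqrt (Nat.cast_nonneg _)]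
    simp
  rw [innerC, Finset.mul_sum, Finset.sum_filter]
  refine Finset.sum_congr rfl fun x _ => ?_
  by_cases h : x - a ∈ E
  · by_cases h' : x - a' ∈ E
    · rw [gabor_normIndicator_of_mem b h, gabor_normIndicator_of_mem b' h', if_pos ⟨h, h'⟩,
        ← hs, ← chi_mul_conj_chi, map_mul, map_inv₀, Complex.conj_ofReal]
      ring
    · rw [gabor_normIndicator_of_notMem b' h', if_neg fun H => h' H.2]
      simp
  · rw [gabor_normIndicator_of_notMem b h, if_neg fun H => h H.1]
    simp

lemma sum_translate_chi (E : Finset (Fin d → ZMod p)) (a c : Fin d → ZMod p) :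
    ∑ x with x - a ∈ E ∧ x - a ∈ E, chi p (dotp x c) =
      chi p (dotp a c) * ∑ y ∈ E, chi p (dotp y c) := by
  rw [Finset.mul_sum]
  refine Finset.sum_bij' (fun x _ => x - a) (fun y _ => y + a) ?_ ?_ ?_ ?_ ?_
  · intro x hx
    exact (Finset.mem_filter.1 hx).2.1
  · intro y hy
    simpa using hy
  · intro x _
    simp
  · intro y _
    simp
  · intro x _
    rw [mul_comm, ← chi_dotp_add_left, sub_add_cancel]

lemma isTilingPair_iff :
    IsTilingPair E A ↔ (∀ x, ∃ a ∈ A, x - a ∈ E) ∧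
      ∀ x, ∀ a ∈ A, ∀ a' ∈ A, x - a ∈ E → x - a' ∈ E → a = a' := by
  unfold IsTilingPair
  simp only [← Finset.card_filter, Finset.card_eq_one, Finset.ext_iff, Finset.mem_filter,
    Finset.mem_singleton]
  constructor
  · intro h
    refine ⟨fun x => ?_, fun x a ha a' ha' h₁ h₂ => ?_⟩
    · obtain ⟨a, h'⟩ := h x
      exact ⟨a, (h' a).2 rfl⟩
    · obtain ⟨c, h'⟩ := h x
      exact ((h' a).1 ⟨ha, h₁⟩).trans ((h' a').1 ⟨ha', h₂⟩).symm
  · rintro ⟨h₁, h₂⟩ x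
    obtain ⟨a, ha, hx⟩ := h₁ x
    refine ⟨a, fun a' => ⟨fun h => h₂ x a' h.1 a ha h.2 hx, ?_⟩⟩
    rintro rfl
    exact ⟨ha, hx⟩

lemma IsGaborONB.isTilingPair (hE : E.Nonempty) (h : IsGaborONB (normIndicator E) A B) :
    IsTilingPair E A := by
  obtain ⟨horth, hspan⟩ := h
  obtain ⟨c, hc⟩ := hspan 1
  have hsum (x : Fin d → ZMod p) :
      ∑ a ∈ A, ∑ b ∈ B, c a b * gabor (normIndicator E) a b x ≠ 0 := by
    rw [← congrFun hc x]
    exact one_ne_zero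
  have hne (x : Fin d → ZMod p) : ∃ a ∈ A, ∃ b ∈ B, x - a ∈ E := by
    obtain ⟨a, ha, h₁⟩ := Finset.exists_ne_zero_of_sum_ne_zero (hsum x)
    obtain ⟨b, hb, h₂⟩ := Finset.exists_ne_zero_of_sum_ne_zero h₁
    refine ⟨a, ha, b, hb, ?_⟩
    by_contra hx
    exact h₂ (by rw [gabor_normIndicator_of_notMem b hx, mul_zero])
  refine isTilingPair_iff.2 ⟨fun x => ?_, fun x a ha a' ha' h₁ h₂ => ?_⟩
  · obtain ⟨a, ha, _, _, hx⟩ := hne x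
    exact ⟨a, ha, hx⟩
  · obtain ⟨_, _, b, hb, _⟩ := hne x
    by_contra haa
    have key := horth a ha b hb a' ha' b hb
    rw [innerC_gabor_normIndicator, if_neg fun H => haa H.1, sub_self] at key
    simp only [chi_dotp_zero_right, Finset.sum_const, nsmul_eq_mul, mul_one, mul_eq_zero,
      inv_eq_zero, Nat.cast_eq_zero, Finset.card_eq_zero] at key
    rcases key with key | key
    · exact hE.ne_empty key
    · exact Finset.notMem_empty x (key ▸ Finset.mem_filter.2 ⟨Finset.mem_univ x, h₁, h₂⟩)

lemma IsGaborONB.isSpectralPair (hE : E.Nonempty) (h : IsGaborONB (normIndicator E) A B) :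
    IsSpectralPair E B := by
  obtain ⟨hcover, hdisj⟩ := isTilingPair_iff.1 (h.isTilingPair hE)
  obtain ⟨horth, hspan⟩ := h
  obtain ⟨a, ha, _⟩ := hcover 0
  have hcard : (E.card : ℂ) ≠ 0 := Nat.cast_ne_zero.2 hE.card_pos.ne'
  refine ⟨fun b hb b' hb' hne => ?_, fun f => ?_⟩
  · have key := horth a ha b hb a ha b' hb'
    rw [innerC_gabor_normIndicator, sum_translate_chi, if_neg fun H => hne H.2] at key
    simpa [hcard, chi_ne_zero] using key
  · obtain ⟨c, hc⟩ := hspan fun x => f (x - a)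
    refine ⟨fun b => c a b * (((Real.sqrt E.card : ℝ) : ℂ)⁻¹ * chi p (dotp a b)),
      fun y hy => ?_⟩
    have hy' : y + a - a ∈ E := by rwa [add_sub_cancel_right]
    have key := congrFun hc (y + a)
    rw [sum_gabor_normIndicator hdisj c ha hy', add_sub_cancel_right] at key
    rw [key]
    refine Finset.sum_congr rfl fun b _ => ?_
    rw [chi_dotp_add_left]
    ring

lemma IsSpectralPair.isGaborONB (hE : E.Nonempty) (hB : IsSpectralPair E B)
    (hA : IsTilingPair E A) : IsGaborONB (normIndicator E) A B := by
  obtain ⟨hcover, hdisj⟩ := isTilingPair_iff.1 hA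
  obtain ⟨horth, hspan⟩ := hB
  have hcard : (E.card : ℂ) ≠ 0 := Nat.cast_ne_zero.2 hE.card_pos.ne'
  refine ⟨fun a ha b hb a' ha' b' hb' => ?_, fun f => ?_⟩
  · rw [innerC_gabor_normIndicator]
    by_cases haa : a = a'
    · subst haa
      rw [sum_translate_chi]
      by_cases hbb : b = b'
      · subst hbb
        simp [chi_dotp_zero_right, hcard]
      · rw [horth b hb b' hb' hbb, if_neg fun H => hbb H.2, mul_zero, mul_zero]
    · rw [if_neg fun H => haa H.1, Finset.filter_false_of_mem, Finset.sum_empty, mul_zero]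
      exact fun x _ H => haa (hdisj x a ha a' ha' H.1 H.2)
  · choose c hc using fun a : Fin d → ZMod p => hspan fun y => f (y + a)
    refine ⟨fun a b => c a b * ((Real.sqrt E.card : ℝ) : ℂ) * (chi p (dotp a b))⁻¹,
      funext fun x => ?_⟩
    obtain ⟨a, ha, hx⟩ := hcover x
    have key := hc a (x - a) hx
    rw [sub_add_cancel] at key
    rw [sum_gabor_normIndicator hdisj _ ha hx, key]
    refine Finset.sum_congr rfl fun b _ => ?_
    have hxb : chi p (dotp x b) = chi p (dotp (x - a) b) * chi p (dotp a b) := by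
      rw [← chi_dotp_add_left, sub_add_cancel]
    have h₁ := sqrt_card_ne_zero hE
    have h₂ := chi_ne_zero (dotp a b)
    rw [hxb]
    field_simp

end GaborIndicator

/-- For nonempty `E ⊆ ℤ_p^d`, the Gabor system
`𝒢(|E|^{-1/2} 1_E, A, B)` is an orthonormal basis of `L²(ℤ_p^d)` iff `(E,B)` is a
spectral pair and `(E,A)` is a tiling pair. -/
theorem gabor_indicator_onb_iff_spectral_and_tiling
    (p : ℕ) [Fact p.Prime] (d : ℕ) (hd : 1 ≤ d)
    (E A B : Finset (Fin d → ZMod p)) (hE : E.Nonempty) :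
    IsGaborONB (fun x => ((Real.sqrt E.card : ℝ) : ℂ)⁻¹ * (if x ∈ E then 1 else 0)) A B ↔
      IsSpectralPair E B ∧ IsTilingPair E A :=
  ⟨fun h => ⟨h.isSpectralPair hE, h.isTilingPair hE⟩, fun h => h.1.isGaborONB hE h.2⟩
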